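/- Define S₁(e) = (2/e⁵)[ 9e(3 − 5e² + 2e⁴) − √(1−e²)(27 − 36e² + 8e⁴) arcsin(e) ] for e ∈ (0,1). Then S₁(e) > 0 for all e ∈ (0,1). -/

import Mathlib

open Real

noncomputable def S₁ (e : ℝ) : ℝ :=
  (2 / e ^ 5) * (9 * e * (3 - 5 * e ^ 2 + 2 * e ^ 4)
    - Real.sqrt (1 - e ^ 2) * (27 - 36 * e ^ 2 + 8 * e ^ 4) * Real.arcsin e)

/-- The double-angle form of the inequality, where the factor multiplying `u` is positive. -/
lemma mul_lt_sin_mul_cos_add_two {u : ℝ} (hu₀ : 0 < u) (huπ : u < π)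
    (hP : 0 < 11 + 14 * cos u + 2 * cos u ^ 2) :
    u * (11 + 14 * cos u + 2 * cos u ^ 2) < 9 * sin u * (2 + cos u) := by
  have hP' : ∀ x ∈ Set.Icc 0 u, 0 < 11 + 14 * cos x + 2 * cos x ^ 2 := by
    intro x hx
    have hc : cos u ≤ cos x := cos_le_cos_of_nonneg_of_le_pi hx.1 huπ.le hx.2
    nlinarith [neg_one_le_cos x, neg_one_le_cos u]
  have hderiv : ∀ x ∈ Set.Icc 0 u,
      HasDerivAt (fun x ↦ 9 * sin x * (2 + cos x) / (11 + 14 * cos x + 2 * cos x ^ 2) - x)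
        ((1 - cos x) ^ 2 * (32 + 26 * cos x - 4 * cos x ^ 2) /
          (11 + 14 * cos x + 2 * cos x ^ 2) ^ 2) x := by
    intro x hx
    have hne := (hP' x hx).ne'
    have hN := ((hasDerivAt_sin x).const_mul 9).mul ((hasDerivAt_cos x).const_add 2)
    have hD := (((hasDerivAt_cos x).const_mul 14).const_add 11).add
      (((hasDerivAt_cos x).pow 2).const_mul 2)
    refine ((hN.div hD hne).sub (hasDerivAt_id x)).congr_deriv ?_
    simp only [Pi.add_apply, Pi.mul_apply, Pi.pow_apply]
    rw [div_sub_one (pow_ne_zero 2 hne)]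
    congr 1
    norm_num
    linear_combination (9 * (2 + cos x) * (14 + 4 * cos x)
      - 9 * (11 + 14 * cos x + 2 * cos x ^ 2)) * sin_sq_add_cos_sq x
  have hmono : StrictMonoOn
      (fun x ↦ 9 * sin x * (2 + cos x) / (11 + 14 * cos x + 2 * cos x ^ 2) - x)
      (Set.Icc 0 u) := by
    refine strictMonoOn_of_deriv_pos (convex_Icc 0 u)
      (fun x hx ↦ (hderiv x hx).continuousAt.continuousWithinAt) fun x hx ↦ ?_
    rw [interior_Icc] at hx
    have hx' := Set.Ioo_subset_Icc_self hx
    rw [(hderiv x hx').deriv]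
    have hlt : cos x < 1 := by
      simpa using cos_lt_cos_of_nonneg_of_le_pi le_rfl (hx.2.trans huπ).le hx.1
    have hquad : 0 < 32 + 26 * cos x - 4 * cos x ^ 2 := by
      nlinarith [neg_one_le_cos x]
    have := hP' x hx'
    have := sub_pos.2 hlt
    positivity
  have h := hmono (Set.left_mem_Icc.2 hu₀.le) (Set.right_mem_Icc.2 hu₀.le) hu₀
  simp only [sin_zero, mul_zero, zero_mul, zero_div, sub_zero, sub_pos] at h
  exact (lt_div_iff₀ hP).1 h

theorem S₁_pos : ∀ e ∈ Set.Ioo (0 : ℝ) 1, 0 < S₁ e := by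
  rintro e ⟨he₀, he₁⟩
  have ht₀ : 0 < arcsin e := arcsin_pos.2 he₀
  have ht₁ : arcsin e < π / 2 := arcsin_lt_pi_div_two.2 he₁
  have hr : 0 < 1 - e ^ 2 := by nlinarith
  have hs : 0 < √(1 - e ^ 2) := sqrt_pos.2 hr
  have hsq : √(1 - e ^ 2) ^ 2 = 1 - e ^ 2 := sq_sqrt hr.le
  have hsin : sin (arcsin e) = e := sin_arcsin (by linarith) he₁.le
  have hsin2 : sin (2 * arcsin e) = 2 * e * √(1 - e ^ 2) := by
    rw [sin_two_mul, hsin, cos_arcsin]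
  have hcos2 : cos (2 * arcsin e) = 1 - 2 * e ^ 2 := by
    rw [cos_two_mul, cos_arcsin, hsq]; ring
  have key : (27 - 36 * e ^ 2 + 8 * e ^ 4) * arcsin e <
      9 * e * √(1 - e ^ 2) * (3 - 2 * e ^ 2) := by
    rcases le_or_gt (27 - 36 * e ^ 2 + 8 * e ^ 4) 0 with hP | hP
    · have h3 : 0 < 3 - 2 * e ^ 2 := by linarith
      exact (mul_nonpos_of_nonpos_of_nonneg hP ht₀.le).trans_lt (by positivity)
    · have h := mul_lt_sin_mul_cos_add_two (u := 2 * arcsin e) (by linarith) (by linarith)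
        (by rw [hcos2]; linarith)
      rw [hsin2, hcos2] at h
      linarith
  unfold S₁
  refine mul_pos (by positivity) ?_
  have hfac : 9 * e * (3 - 5 * e ^ 2 + 2 * e ^ 4)
      - √(1 - e ^ 2) * (27 - 36 * e ^ 2 + 8 * e ^ 4) * arcsin e
      = √(1 - e ^ 2) * (9 * e * √(1 - e ^ 2) * (3 - 2 * e ^ 2)
        - (27 - 36 * e ^ 2 + 8 * e ^ 4) * arcsin e) := by
    linear_combination -(9 * e * (3 - 2 * e ^ 2)) * hsq
  rw [hfac]
  exact mul_pos hs (sub_pos.2 key)
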